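/- Let Q₀,Q₁,…,Q_r be real binary quadratic forms with positive discriminant such that Q_r=Q₀=Q, and let M₁,…,M_r∈SL(2,ℤ) satisfy Q_j = Q_{j−1}|M_j for j=1,…,r; set γ := M₁·M₂⋯M_r, so that γQ=Q. Let Ψ be as in the context and z₀∈ℍ. Then Int(Q,γ;z₀) = Σ_{j=1}^{r} ∫₀¹ Ψ(σ_j(t),Q_{j−1})·σ_j'(t)/Q_{j−1}(σ_j(t)) dt, where σ_j(t)=z₀+t(M_j·z₀−z₀) is the straight segment from z₀ to M_j·z₀. -/

import Mathlib

open Complex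

noncomputable section

/-- A real binary quadratic form `Q = [A,B,C]`, as a triple of coefficients. -/
abbrev QF : Type := ℝ × ℝ × ℝ

/-- Discriminant `D = B² - 4AC`. -/
def disc (Q : QF) : ℝ := Q.2.1 ^ 2 - 4 * Q.1 * Q.2.2

/-- The value `Q(z) = A z² + B z + C`. -/
def Qpoly (Q : QF) (z : ℂ) : ℂ := (Q.1 : ℂ) * z ^ 2 + (Q.2.1 : ℂ) * z + (Q.2.2 : ℂ)

/-- The right action `Q|g` of `g = [[a,b],[c,d]]` on forms:
`(Q|g)(x,y) = Q(ax+by, cx+dy)`. -/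
def Qslash (Q : QF) (a b c d : ℝ) : QF :=
  (Q.1 * a ^ 2 + Q.2.1 * a * c + Q.2.2 * c ^ 2,
   2 * Q.1 * a * b + Q.2.1 * (a * d + b * c) + 2 * Q.2.2 * c * d,
   Q.1 * b ^ 2 + Q.2.1 * b * d + Q.2.2 * d ^ 2)

abbrev SL2Z := Matrix.SpecialLinearGroup (Fin 2) ℤ

/-- `Q|g` for an integral matrix `g ∈ SL(2,ℤ)`. -/
def QslashZ (Q : QF) (g : SL2Z) : QF :=
  Qslash Q ((g.1 0 0 : ℤ) : ℝ) ((g.1 0 1 : ℤ) : ℝ) ((g.1 1 0 : ℤ) : ℝ) ((g.1 1 1 : ℤ) : ℝ)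

/-- The left action `gQ := Q|g⁻¹`. -/
def QAct (g : SL2Z) (Q : QF) : QF := QslashZ Q g⁻¹

/-- The Möbius action `g·z = (az+b)/(cz+d)` of `g ∈ SL(2,ℤ)` on `z ∈ ℂ`. -/
def moebZ (g : SL2Z) (z : ℂ) : ℂ :=
  (((g.1 0 0 : ℤ) : ℂ) * z + ((g.1 0 1 : ℤ) : ℂ)) /
    (((g.1 1 0 : ℤ) : ℂ) * z + ((g.1 1 1 : ℤ) : ℂ))

/-- The hyperbolic period `Int(Q,γ;z₀) = ∫_{z₀}^{γz₀} Ψ(z,Q) dz/Q(z)`, the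
integral being taken over the straight segment `σ(t) = z₀ + t(γz₀ − z₀)`,
`t ∈ [0,1]` (legitimate since `Q` has only real zeros and `ℍ` is convex). -/
def IntQ (Ψ : QF → ℂ → ℂ) (Q : QF) (γ : SL2Z) (z₀ : ℂ) : ℂ :=
  ∫ t in (0:ℝ)..1,
    Ψ Q (z₀ + (t : ℂ) * (moebZ γ z₀ - z₀)) * (moebZ γ z₀ - z₀) /
      Qpoly Q (z₀ + (t : ℂ) * (moebZ γ z₀ - z₀))

theorem SL2Z.det_eq_one (g : SL2Z) : g.1 0 0 * g.1 1 1 - g.1 0 1 * g.1 1 0 = 1 := by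
  rw [← Matrix.det_fin_two, g.2]

theorem QslashZ_one (Q : QF) : QslashZ Q 1 = Q := by
  simp [QslashZ, Qslash]

theorem QslashZ_mul (Q : QF) (g h : SL2Z) : QslashZ Q (g * h) = QslashZ (QslashZ Q g) h := by
  simp only [QslashZ, Qslash, Matrix.SpecialLinearGroup.coe_mul, Matrix.mul_apply,
    Fin.sum_univ_two, Int.cast_add, Int.cast_mul, Prod.mk.injEq]
  refine ⟨?_, ?_, ?_⟩ <;> ring

theorem QAct_QslashZ (Q : QF) (g : SL2Z) : QAct g (QslashZ Q g) = Q := by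
  rw [QAct, ← QslashZ_mul, mul_inv_cancel, QslashZ_one]

theorem disc_QslashZ (Q : QF) (g : SL2Z) : disc (QslashZ Q g) = disc Q := by
  have h : ((g.1 0 0 : ℤ) : ℝ) * (g.1 1 1 : ℤ) - (g.1 0 1 : ℤ) * (g.1 1 0 : ℤ) = 1 := by
    exact_mod_cast g.det_eq_one
  calc disc (QslashZ Q g)
      = disc Q * (((g.1 0 0 : ℤ) : ℝ) * (g.1 1 1 : ℤ) - (g.1 0 1 : ℤ) * (g.1 1 0 : ℤ)) ^ 2 := by
        simp only [disc, QslashZ, Qslash]; ring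
    _ = disc Q := by rw [h, one_pow, mul_one]

/-- A form of positive discriminant has no zero in the upper half-plane. -/
theorem Qpoly_ne_zero {Q : QF} (hQ : 0 < disc Q) {z : ℂ} (hz : 0 < z.im) : Qpoly Q z ≠ 0 := by
  intro h
  have hre := congrArg Complex.re h
  have him := congrArg Complex.im h
  simp only [Qpoly, sq, add_re, add_im, mul_re, mul_im, ofReal_re, ofReal_im, zero_re,
    zero_im] at hre him
  have hB : Q.2.1 = -2 * Q.1 * z.re := by
    apply mul_right_cancel₀ hz.ne'
    linarith
  have hC : Q.2.2 = Q.1 * (z.re ^ 2 + z.im ^ 2) := by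
    rw [hB] at hre
    linarith
  have hD : disc Q = -(2 * Q.1 * z.im) ^ 2 := by
    rw [disc, hB, hC]; ring
  linarith [sq_nonneg (2 * Q.1 * z.im)]

theorem SL2Z.denom_ne_zero (g : SL2Z) {z : ℂ} (hz : 0 < z.im) :
    ((g.1 1 0 : ℤ) : ℂ) * z + ((g.1 1 1 : ℤ) : ℂ) ≠ 0 := by
  intro h
  have him := congrArg Complex.im h
  have hre := congrArg Complex.re h
  simp only [add_im, mul_im, add_re, mul_re, intCast_re, intCast_im, zero_mul, add_zero, sub_zero,
    zero_im, zero_re, mul_eq_zero, hz.ne', or_false] at him hre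
  rw [him, zero_mul, zero_add, Int.cast_eq_zero] at hre
  rw [Int.cast_eq_zero] at him
  have hdet := g.det_eq_one
  simp [him, hre] at hdet

theorem moebZ_one (z : ℂ) : moebZ 1 z = z := by
  simp [moebZ]

theorem moebZ_mul (g h : SL2Z) {z : ℂ} (hz : 0 < z.im) :
    moebZ (g * h) z = moebZ g (moebZ h z) := by
  have hd := h.denom_ne_zero hz
  have hlin {d : ℂ} (hd : d ≠ 0) (a b n : ℂ) : a * (n / d) + b = (a * n + b * d) / d := by
    field_simp
  simp only [moebZ, Matrix.SpecialLinearGroup.coe_mul, Matrix.mul_apply, Fin.sum_univ_two,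
    Int.cast_add, Int.cast_mul]
  rw [hlin hd, hlin hd, div_div_div_cancel_right₀ hd]
  congr 1 <;> ring

theorem moebZ_im_pos (g : SL2Z) {z : ℂ} (hz : 0 < z.im) : 0 < (moebZ g z).im := by
  have hd := normSq_pos.mpr (g.denom_ne_zero hz)
  have hdet : ((g.1 0 0 : ℤ) : ℝ) * (g.1 1 1 : ℤ) - (g.1 0 1 : ℤ) * (g.1 1 0 : ℤ) = 1 := by
    exact_mod_cast g.det_eq_one
  rw [moebZ, div_im, ← sub_div]
  refine div_pos ?_ hd
  simp only [add_im, mul_im, add_re, mul_re, intCast_re, intCast_im, zero_mul, add_zero, sub_zero]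
  calc (0 : ℝ) < z.im * (((g.1 0 0 : ℤ) : ℝ) * (g.1 1 1 : ℤ) - (g.1 0 1 : ℤ) * (g.1 1 0 : ℤ)) := by
        rwa [hdet, mul_one]
    _ = _ := by ring

theorem hasDerivAt_moebZ (g : SL2Z) {z : ℂ} (hz : 0 < z.im) :
    HasDerivAt (moebZ g) (1 / (((g.1 1 0 : ℤ) : ℂ) * z + ((g.1 1 1 : ℤ) : ℂ)) ^ 2) z := by
  have hlin (a b : ℂ) : HasDerivAt (fun w => a * w + b) a z := by
    simpa using ((hasDerivAt_id z).const_mul a).add_const b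
  have hdet : ((g.1 0 0 : ℤ) : ℂ) * (g.1 1 1 : ℤ) - (g.1 0 1 : ℤ) * (g.1 1 0 : ℤ) = 1 := by
    exact_mod_cast g.det_eq_one
  refine ((hlin _ _).div (hlin _ _) (g.denom_ne_zero hz)).congr_deriv ?_
  rw [← hdet]
  ring

theorem Qpoly_QslashZ (Q : QF) (g : SL2Z) {z : ℂ} (hz : 0 < z.im) :
    Qpoly (QslashZ Q g) z =
      (((g.1 1 0 : ℤ) : ℂ) * z + ((g.1 1 1 : ℤ) : ℂ)) ^ 2 * Qpoly Q (moebZ g z) := by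
  have hd := g.denom_ne_zero hz
  simp only [Qpoly, moebZ, QslashZ, Qslash]
  push_cast
  field_simp
  ring

theorem convex_im_pos : Convex ℝ {z : ℂ | 0 < z.im} :=
  convex_halfSpace_im_gt 0

theorem isOpen_im_pos : IsOpen {z : ℂ | 0 < z.im} :=
  isOpen_lt continuous_const continuous_im

section Primitive

variable {Ψ : QF → ℂ → ℂ} {Q : QF}

theorem differentiableOn_div_Qpoly
    (hΨ : DifferentiableOn ℂ (Ψ Q) {z : ℂ | 0 < z.im}) (hQ : 0 < disc Q) :
    DifferentiableOn ℂ (fun z => Ψ Q z / Qpoly Q z) {z : ℂ | 0 < z.im} := by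
  refine hΨ.fun_div (Differentiable.differentiableOn ?_) fun z hz => Qpoly_ne_zero hQ hz
  unfold Qpoly
  fun_prop

theorem exists_primitive_div_Qpoly
    (hΨ : DifferentiableOn ℂ (Ψ Q) {z : ℂ | 0 < z.im}) (hQ : 0 < disc Q) :
    ∃ F : ℂ → ℂ, ∀ z : ℂ, 0 < z.im → HasDerivAt F (Ψ Q z / Qpoly Q z) z := by
  obtain ⟨F, hF⟩ :=
    convex_im_pos.exists_forall_hasDerivWithinAt (differentiableOn_div_Qpoly hΨ hQ)
  exact ⟨F, fun z hz => (hF z hz).hasDerivAt (isOpen_im_pos.mem_nhds hz)⟩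

/-- If `F` is a primitive of `Ψ(·,Q)/Q`, then `F ∘ g` is one of `Ψ(·,Q|g)/(Q|g)`. -/
theorem hasDerivAt_comp_moebZ
    (hΨinv : ∀ Q : QF, 0 < disc Q → ∀ g : SL2Z, ∀ z : ℂ, 0 < z.im →
      Ψ (QAct g Q) (moebZ g z) = Ψ Q z) (hQ : 0 < disc Q) {F : ℂ → ℂ}
    (hF : ∀ z : ℂ, 0 < z.im → HasDerivAt F (Ψ Q z / Qpoly Q z) z) (g : SL2Z) {z : ℂ}
    (hz : 0 < z.im) :
    HasDerivAt (fun w => F (moebZ g w)) (Ψ (QslashZ Q g) z / Qpoly (QslashZ Q g) z) z := by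
  have hΨ := hΨinv (QslashZ Q g) (by rwa [disc_QslashZ]) g z hz
  rw [QAct_QslashZ] at hΨ
  refine ((hF _ (moebZ_im_pos g hz)).comp z (hasDerivAt_moebZ g hz)).congr_deriv ?_
  rw [hΨ, Qpoly_QslashZ Q g hz, div_mul_div_comm, mul_one, mul_comm (Qpoly _ _)]

theorem integral_segment_eq_sub
    (hΨ : DifferentiableOn ℂ (Ψ Q) {z : ℂ | 0 < z.im}) (hQ : 0 < disc Q) {F : ℂ → ℂ}
    (hF : ∀ z : ℂ, 0 < z.im → HasDerivAt F (Ψ Q z / Qpoly Q z) z) {z w : ℂ}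
    (hz : 0 < z.im) (hw : 0 < w.im) :
    (∫ t in (0:ℝ)..1, Ψ Q (z + (t : ℂ) * (w - z)) * (w - z) / Qpoly Q (z + (t : ℂ) * (w - z))) =
      F w - F z := by
  have hmem : ∀ t ∈ Set.uIcc (0 : ℝ) 1, z + (t : ℂ) * (w - z) ∈ {z : ℂ | 0 < z.im} := by
    intro t ht
    rw [Set.uIcc_of_le zero_le_one] at ht
    simpa [AffineMap.lineMap_apply, add_comm] using convex_im_pos.add_smul_sub_mem hz hw ht
  have hσ (t : ℝ) : HasDerivAt (fun s : ℝ => z + (s : ℂ) * (w - z)) (w - z) t := by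
    simpa using (ofRealCLM.hasDerivAt.mul_const (w - z)).const_add z
  simp only [mul_div_right_comm]
  rw [intervalIntegral.integral_eq_sub_of_hasDerivAt
    (f := fun t : ℝ => F (z + (t : ℂ) * (w - z)))]
  · simp
  · exact fun t ht => (hF _ (hmem t ht)).comp t (hσ t)
  · refine ContinuousOn.intervalIntegrable (ContinuousOn.mul ?_ continuousOn_const)
    exact (differentiableOn_div_Qpoly hΨ hQ).continuousOn.comp
      (f := fun t : ℝ => z + (t : ℂ) * (w - z)) (by fun_prop) hmem

end Primitive

/-- Let `Q₀, Q₁, …, Q_r` be real quadratic forms of positive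
discriminant with `Q_r = Q₀ = Q`, let `M₁, …, M_r ∈ SL(2,ℤ)` satisfy
`Q_j = Q_{j-1}|M_j`, and set `γ := M₁·M₂⋯M_r` (so `γQ = Q`).  Let `Ψ` be an
`SL(2,ℤ)`-invariant family of holomorphic functions as in the context and
`z₀ ∈ ℍ`.  Then the hyperbolic period decomposes:
`Int(Q,γ;z₀) = Σ_{j=1}^{r} ∫₀¹ Ψ(σ_j(t),Q_{j-1})·σ_j'(t)/Q_{j-1}(σ_j(t)) dt`,
where `σ_j(t) = z₀ + t(M_j·z₀ − z₀)`. -/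
theorem IntQ_decomposition (Ψ : QF → ℂ → ℂ)
    (hΨhol : ∀ Q : QF, 0 < disc Q →
      DifferentiableOn ℂ (Ψ Q) {z : ℂ | 0 < z.im})
    (hΨinv : ∀ Q : QF, 0 < disc Q → ∀ g : SL2Z, ∀ z : ℂ, 0 < z.im →
      Ψ (QAct g Q) (moebZ g z) = Ψ Q z)
    (r : ℕ) (Qs : ℕ → QF) (M : ℕ → SL2Z)
    (hdisc : ∀ j ≤ r, 0 < disc (Qs j))
    (hcycle : Qs r = Qs 0)
    (hstep : ∀ j, 1 ≤ j → j ≤ r → Qs j = QslashZ (Qs (j - 1)) (M j))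
    (z₀ : ℂ) (h₀ : 0 < z₀.im) :
    IntQ Ψ (Qs 0) (((List.range r).map fun j => M (j + 1)).prod) z₀ =
      ∑ j ∈ Finset.range r,
        ∫ t in (0:ℝ)..1,
          Ψ (Qs j) (z₀ + (t : ℂ) * (moebZ (M (j + 1)) z₀ - z₀)) *
              (moebZ (M (j + 1)) z₀ - z₀) /
            Qpoly (Qs j) (z₀ + (t : ℂ) * (moebZ (M (j + 1)) z₀ - z₀)) := by
  set γ : ℕ → SL2Z := fun j => ((List.range j).map fun j => M (j + 1)).prod with hγ
  have hγ_succ (j : ℕ) : γ (j + 1) = γ j * M (j + 1) := by simp [hγ, List.range_succ]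
  have hQs : ∀ j ≤ r, Qs j = QslashZ (Qs 0) (γ j) := by
    intro j
    induction j with
    | zero => simp [hγ, QslashZ_one]
    | succ j ih =>
      intro hj
      rw [hstep (j + 1) (by omega) hj, Nat.add_sub_cancel, ih (by omega), hγ_succ, QslashZ_mul]
  have hQ₀ := hdisc 0 r.zero_le
  obtain ⟨F, hF⟩ := exists_primitive_div_Qpoly (hΨhol _ hQ₀) hQ₀
  calc IntQ Ψ (Qs 0) (γ r) z₀ = F (moebZ (γ r) z₀) - F (moebZ (γ 0) z₀) := by
        rw [IntQ, integral_segment_eq_sub (hΨhol _ hQ₀) hQ₀ hF h₀ (moebZ_im_pos _ h₀)]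
        simp [hγ, moebZ_one]
    _ = ∑ j ∈ Finset.range r, (F (moebZ (γ (j + 1)) z₀) - F (moebZ (γ j) z₀)) :=
        (Finset.sum_range_sub (fun j => F (moebZ (γ j) z₀)) r).symm
    _ = _ := Finset.sum_congr rfl fun j hj => by
        have hj' := (Finset.mem_range.mp hj).le
        have hQj := hdisc j hj'
        have hFj : ∀ z : ℂ, 0 < z.im →
            HasDerivAt (fun w => F (moebZ (γ j) w)) (Ψ (Qs j) z / Qpoly (Qs j) z) z := by
          rw [hQs j hj']
          exact fun z hz => hasDerivAt_comp_moebZ hΨinv hQ₀ hF (γ j) hz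
        rw [integral_segment_eq_sub (hΨhol _ hQj) hQj hFj h₀ (moebZ_im_pos _ h₀), hγ_succ,
          moebZ_mul _ _ h₀]
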